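/- arXiv:2005.08779 — 3 statements merged into one kernel-verified Lean document; each statement's English description precedes it below -/
import Mathlib

section
/- Let M be a reduced left A-module such that both M and its A-dual M* are semi-Gorenstein-projective. Choose a minimal projective resolution ⋯ → P₂ →f₂ P₁ →f₁ P₀ →e M → 0 of M and a minimal projective resolution 0 ← M* ←q Q₀ ←d₁ Q₁ ←d₂ Q₂ ← ⋯ of the right A-module M*. For i < 0 set P_i = Q_{-i-1}* and f_i = d_{-i}* : P_{-i} → P_{-i-1} (applied at the appropriate indices), and set f₀ = q* ∘ φ_M ∘ e : P₀ → P₋₁. Then P_• = (P_i, f_i) is a minimal complex of projective left A-modules with H_i(P_•) = 0 for all i ≠ 0, −1, H₀(P_•) ≅ Ker φ_M, H₋₁(P_•) ≅ Cok φ_M, and the A-dual complex P_•* is acyclic; moreover M ≅ Cok f₁ and M* ≅ Cok f₋₁*. -/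
/-!
Common background: `A` is an artin algebra (an algebra over a commutative artinian
ring `k`, finitely generated as `k`-module).  Left `A`-modules are `Module A M`;
right `A`-modules are `Module Aᵐᵒᵖ N`.  `Dl A M = Hom_A(M,A)` is the `A`-dual of a
left module (a right module) and `Dr A N` the dual of a right module (a left module);
`evalL A M : M → M**` is the canonical evaluation map `φ_M`.
-/

open CategoryTheory LinearMap

universe u

section Preliminaries

variable (A : Type u) [Ring A]

/-- The `A`-dual of a left `A`-module: `M* = Hom_A(M, A)`, a right `A`-module. -/
abbrev Dl (M : Type u) [AddCommGroup M] [Module A M] : Type u := M →ₗ[A] A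

/-- The `A`-dual of a right `A`-module: a left `A`-module. -/
abbrev Dr (N : Type u) [AddCommGroup N] [Module Aᵐᵒᵖ N] : Type u := N →ₗ[Aᵐᵒᵖ] A

variable {A}

/-- The dual of a map of left modules. -/
def dualMapL {M N : Type u} [AddCommGroup M] [Module A M] [AddCommGroup N] [Module A N]
    (g : M →ₗ[A] N) : Dl A N →ₗ[Aᵐᵒᵖ] Dl A M where
  toFun h := h.comp g
  map_add' h₁ h₂ := by ext; simp
  map_smul' a h := by ext; simp

/-- The dual of a map of right modules. -/
def dualMapR {M N : Type u} [AddCommGroup M] [Module Aᵐᵒᵖ M] [AddCommGroup N] [Module Aᵐᵒᵖ N]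
    (g : M →ₗ[Aᵐᵒᵖ] N) : Dr A N →ₗ[A] Dr A M where
  toFun h := h.comp g
  map_add' h₁ h₂ := by ext; simp
  map_smul' a h := by ext; simp

variable (A)

/-- The canonical evaluation map `φ_M : M → M**` for a left module `M`. -/
def evalL (M : Type u) [AddCommGroup M] [Module A M] : M →ₗ[A] Dr A (Dl A M) where
  toFun m :=
    { toFun := fun f => f m
      map_add' := fun f g => rfl
      map_smul' := fun a f => rfl }
  map_add' m m' := by ext f; simp
  map_smul' a m := by ext f; simp

/-- The canonical evaluation map `φ_N : N → N**` for a right module `N`. -/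
def evalR (N : Type u) [AddCommGroup N] [Module Aᵐᵒᵖ N] : N →ₗ[Aᵐᵒᵖ] Dl A (Dr A N) where
  toFun n :=
    { toFun := fun f => f n
      map_add' := fun f g => rfl
      map_smul' := fun a f => rfl }
  map_add' n n' := by ext f; simp
  map_smul' a n := by ext f; simp

/-- The radical of a module: the intersection of all maximal submodules. -/
def radM (M : Type u) [AddCommGroup M] [Module A M] : Submodule A M :=
  sInf {N : Submodule A M | IsCoatom N}

/-- A module is *reduced* if it has no nonzero projective direct summand. -/
def Reduced (M : Type u) [AddCommGroup M] [Module A M] : Prop :=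
  ∀ N N' : Submodule A M, IsCompl N N' → Module.Projective A N → N = ⊥

/-- Vanishing of `Ext^i_A(M, N)`. -/
def extZero (M N : Type u) [AddCommGroup M] [Module A M] [AddCommGroup N] [Module A N]
    (i : ℕ) : Prop :=
  Limits.IsZero (((Ext ℤ (ModuleCat.{u} A) i).obj (Opposite.op (ModuleCat.of A M))).obj
    (ModuleCat.of A N))

/-- A left module `M` is semi-Gorenstein-projective if `Ext^i_A(M, A) = 0` for all `i ≥ 1`. -/
def sGp (M : Type u) [AddCommGroup M] [Module A M] : Prop :=
  ∀ i : ℕ, 1 ≤ i → extZero A M A i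

/-- Semi-Gorenstein-projectivity for right modules, with `A` as right regular module. -/
def sGpR (N : Type u) [AddCommGroup N] [Module Aᵐᵒᵖ N] : Prop :=
  ∀ i : ℕ, 1 ≤ i → extZero Aᵐᵒᵖ N A i

/-- `e : P → M` is a projective cover: `P` is a finitely generated projective module,
`e` is surjective and `ker e ⊆ rad P`. -/
def IsProjCover {P M : Type u} [AddCommGroup P] [Module A P] [AddCommGroup M] [Module A M]
    (e : P →ₗ[A] M) : Prop :=
  Module.Projective A P ∧ Module.Finite A P ∧ Function.Surjective e ∧ ker e ≤ radM A P

/-- `P₁ →f P₀ →e M → 0` is a minimal projective presentation of `M`. -/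
def IsMinPres {P₁ P₀ M : Type u} [AddCommGroup P₁] [Module A P₁] [AddCommGroup P₀] [Module A P₀]
    [AddCommGroup M] [Module A M] (f : P₁ →ₗ[A] P₀) (e : P₀ →ₗ[A] M) : Prop :=
  IsProjCover A e ∧ range f = ker e ∧ Module.Projective A P₁ ∧ Module.Finite A P₁ ∧
    ker f ≤ radM A P₁

/-- A minimal projective resolution `⋯ → P₁ → P₀ → M → 0` (ℕ-indexed). -/
def IsMinProjRes (P : ℕ → Type u) [∀ n, AddCommGroup (P n)] [∀ n, Module A (P n)]
    {M : Type u} [AddCommGroup M] [Module A M]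
    (f : ∀ n, P (n+1) →ₗ[A] P n) (e : P 0 →ₗ[A] M) : Prop :=
  (∀ n, Module.Projective A (P n)) ∧ (∀ n, Module.Finite A (P n)) ∧
    Function.Surjective e ∧ range (f 0) = ker e ∧ (∀ n, range (f (n+1)) = ker (f n)) ∧
    ker e ≤ radM A (P 0) ∧ (∀ n, ker (f n) ≤ radM A (P (n+1)))

section ZComplex

variable (P : ℤ → Type u) [∀ i, AddCommGroup (P i)] [∀ i, Module A (P i)]
  (g : ∀ i : ℤ, P i →ₗ[A] P (i-1))

/-- `(P_i, g_i : P_i → P_{i-1})` is a complex. -/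
def IsComplexZ : Prop := ∀ i : ℤ, (g (i-1)).comp (g i) = 0

/-- A complex is minimal if each image lies in the radical. -/
def IsMinimalZ : Prop := ∀ i : ℤ, range (g i) ≤ radM A (P (i-1))

/-- A complex of (finitely generated) projective modules. -/
def IsProjComplexZ : Prop := ∀ i : ℤ, Module.Projective A (P i) ∧ Module.Finite A (P i)

/-- Exactness at position `i - 1`, i.e. `H_{i-1}(P_•) = 0`. -/
def ExactAtPred (i : ℤ) : Prop := range (g i) = ker (g (i-1))

/-- Acyclicity of the `A`-dual complex `P_•^*`. -/
def DualAcyclicZ : Prop :=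
  ∀ i : ℤ, range (dualMapL (g (i-1))) = ker (dualMapL (g i))

/-- The homology of the complex at position `i - 1`. -/
abbrev HomologyAtPred (i : ℤ) : Type u :=
  ↥(ker (g (i-1))) ⧸ (Submodule.comap (ker (g (i-1))).subtype (range (g i)))

end ZComplex

/-- `Z` is (a representative of) the transpose `Tr M` of the left module `M`. -/
def IsTrL (M : Type u) [AddCommGroup M] [Module A M]
    (Z : Type u) [AddCommGroup Z] [Module Aᵐᵒᵖ Z] : Prop :=
  ∃ (P₁ P₀ : ModuleCat.{u} A) (f : P₁ →ₗ[A] P₀) (e : P₀ →ₗ[A] M),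
    IsMinPres A f e ∧ Nonempty (Z ≃ₗ[Aᵐᵒᵖ] (Dl A P₁ ⧸ range (dualMapL f)))

/-- `M` is (a representative of) the transpose `Tr Z` of the right module `Z`. -/
def IsTrR (Z : Type u) [AddCommGroup Z] [Module Aᵐᵒᵖ Z]
    (M : Type u) [AddCommGroup M] [Module A M] : Prop :=
  ∃ (Q₁ Q₀ : ModuleCat.{u} Aᵐᵒᵖ) (d : Q₁ →ₗ[Aᵐᵒᵖ] Q₀) (c : Q₀ →ₗ[Aᵐᵒᵖ] Z),
    IsMinPres Aᵐᵒᵖ d c ∧ Nonempty (M ≃ₗ[A] (Dr A Q₁ ⧸ range (dualMapR d)))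

/-- `W` is (a representative of) the syzygy `Ω M` of the left module `M`. -/
def IsSyzL (W M : Type u) [AddCommGroup W] [Module A W] [AddCommGroup M] [Module A M] : Prop :=
  ∃ (P : ModuleCat.{u} A) (e : P →ₗ[A] M),
    IsProjCover A e ∧ Nonempty (W ≃ₗ[A] ker e)

/-- `W` is (a representative of) the syzygy `Ω Z` of the right module `Z`. -/
def IsSyzR (W Z : Type u) [AddCommGroup W] [Module Aᵐᵒᵖ W] [AddCommGroup Z] [Module Aᵐᵒᵖ Z] :
    Prop :=
  ∃ (Q : ModuleCat.{u} Aᵐᵒᵖ) (c : Q →ₗ[Aᵐᵒᵖ] Z),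
    IsProjCover Aᵐᵒᵖ c ∧ Nonempty (W ≃ₗ[Aᵐᵒᵖ] ker c)

/-- `W` is a second syzygy `Ω² M`. -/
def IsSyz2L (W M : Type u) [AddCommGroup W] [Module A W] [AddCommGroup M] [Module A M] : Prop :=
  ∃ (V : ModuleCat.{u} A), IsSyzL A V M ∧ IsSyzL A W V

/-- `W` is a second syzygy `Ω² Z` of a right module. -/
def IsSyz2R (W Z : Type u) [AddCommGroup W] [Module Aᵐᵒᵖ W] [AddCommGroup Z] [Module Aᵐᵒᵖ Z] :
    Prop :=
  ∃ (V : ModuleCat.{u} Aᵐᵒᵖ), IsSyzR A V Z ∧ IsSyzR A W V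

/-- A right module `Z` is ∞-torsionfree if its transpose is semi-Gorenstein-projective. -/
def InfTfR (Z : Type u) [AddCommGroup Z] [Module Aᵐᵒᵖ Z] : Prop :=
  ∃ (M : ModuleCat.{u} A), IsTrR A Z M ∧ sGp A M

/-- A left module `M` is ∞-torsionfree if its transpose is semi-Gorenstein-projective. -/
def InfTfL (M : Type u) [AddCommGroup M] [Module A M] : Prop :=
  ∃ (Z : ModuleCat.{u} Aᵐᵒᵖ), IsTrL A M Z ∧ sGpR A Z

/-- Projective dimension at most `n` (for objects of `ModuleCat A`). -/
def projDimLEcat : ℕ → ModuleCat.{u} A → Prop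
  | 0, M => Module.Projective A M
  | (n+1), M => ∃ (P : ModuleCat.{u} A) (e : P →ₗ[A] M),
      Module.Projective A P ∧ Module.Finite A P ∧ Function.Surjective e ∧
        projDimLEcat n (ModuleCat.of A (ker e))

/-- Projective dimension at most `n`. -/
def projDimLE (M : Type u) [AddCommGroup M] [Module A M] (n : ℕ) : Prop :=
  projDimLEcat A n (ModuleCat.of A M)

/-- A Nunke module: a semi-Gorenstein-projective module `M` with `M* = 0`. -/
def NunkeL (M : Type u) [AddCommGroup M] [Module A M] : Prop :=
  sGp A M ∧ ∀ f : Dl A M, f = 0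

end Preliminaries


/-! The glued `ℤ`-indexed complex of Theorem 2.1: the minimal projective resolution of `M`
in degrees `≥ 0`, glued with the dual of the minimal projective resolution of `M^*`
in degrees `< 0`, with connecting differential `f₀ = q^* ∘ φ_M ∘ e`. -/

def predZ : ℤ → ℤ
  | .ofNat 0 => .negSucc 0
  | .ofNat (n+1) => .ofNat n
  | .negSucc n => .negSucc (n+1)

lemma predZ_eq : ∀ i : ℤ, predZ i = i - 1
  | .ofNat 0 => by decide
  | .ofNat (n+1) => show (Int.ofNat n) = Int.ofNat (n+1) - 1 from by simp [Int.ofNat_eq_natCast]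
  | .negSucc n => (Int.negSucc_sub_one n).symm

section Glued

variable (A : Type u) [Ring A]
variable (P : ℕ → Type u) [∀ n, AddCommGroup (P n)] [∀ n, Module A (P n)]
  (Q : ℕ → Type u) [∀ n, AddCommGroup (Q n)] [∀ n, Module Aᵐᵒᵖ (Q n)]

/-- `P_i = P_i` for `i ≥ 0` and `P_i = Q_{-i-1}^*` for `i < 0`. -/
def gluedP : ℤ → Type u
  | .ofNat n => P n
  | .negSucc n => Dr A (Q n)

instance gluedPacg : ∀ i : ℤ, AddCommGroup (gluedP A P Q i)
  | .ofNat n => inferInstanceAs (AddCommGroup (P n))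
  | .negSucc n => inferInstanceAs (AddCommGroup (Dr A (Q n)))

instance gluedPmod : ∀ i : ℤ, Module A (gluedP A P Q i)
  | .ofNat n => inferInstanceAs (Module A (P n))
  | .negSucc n => inferInstanceAs (Module A (Dr A (Q n)))

variable {M : Type u} [AddCommGroup M] [Module A M]
  (f : ∀ n, P (n+1) →ₗ[A] P n) (e : P 0 →ₗ[A] M)
  (d : ∀ n, Q (n+1) →ₗ[Aᵐᵒᵖ] Q n) (q : Q 0 →ₗ[Aᵐᵒᵖ] Dl A M)

/-- The differentials: `f_i` for `i ≥ 1`, `f₀ = q^* ∘ φ_M ∘ e`, `f_i = d_{-i}^*` for `i < 0`. -/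
def gluedF0 : ∀ i : ℤ, gluedP A P Q i →ₗ[A] gluedP A P Q (predZ i)
  | .ofNat 0 => (dualMapR q) ∘ₗ (evalL A M) ∘ₗ e
  | .ofNat (n+1) => f n
  | .negSucc n => dualMapR (d n)

def gluedF (i : ℤ) : gluedP A P Q i →ₗ[A] gluedP A P Q (i - 1) :=
  cast (congrArg (fun j : ℤ => (gluedP A P Q i →ₗ[A] gluedP A P Q j)) (predZ_eq i))
    (gluedF0 A P Q f e d q i)

end Glued

section ExtResolution
variable {R : Type u} [Ring R] {P : ℕ → Type u} [∀ n, AddCommGroup (P n)] [∀ n, Module R (P n)]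
  {M : Type u} [AddCommGroup M] [Module R M] {f : ∀ n, P (n+1) →ₗ[R] P n} {e : P 0 →ₗ[R] M}

/-- The chain complex in `ModuleCat R` given by an exact sequence of modules. -/
noncomputable def chainComplexOfExact (hf : ∀ n, range (f (n+1)) = ker (f n)) :
    ChainComplex (ModuleCat.{u} R) ℕ :=
  ChainComplex.of (fun n => ModuleCat.of R (P n)) (fun n => ModuleCat.ofHom (f n)) (fun n => by
    ext x
    exact (hf n).le ⟨x, rfl⟩)

theorem chainComplexOfExact_d (hf : ∀ n, range (f (n+1)) = ker (f n)) (n : ℕ) :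
    (chainComplexOfExact hf).d (n + 1) n = ModuleCat.ofHom (f n) :=
  ChainComplex.of_d (fun n => ModuleCat.of R (P n)) (fun n => ModuleCat.ofHom (f n)) n

/-- An exact sequence `⋯ → P 1 → P 0 → M → 0` of modules with all `P n` projective, as a
`ProjectiveResolution` of `M` in `ModuleCat R`. -/
noncomputable def projectiveResolutionOfExact (hP : ∀ n, Module.Projective R (P n))
    (he : Function.Surjective e) (h0 : range (f 0) = ker e)
    (hf : ∀ n, range (f (n+1)) = ker (f n)) : ProjectiveResolution (ModuleCat.of R M) where
  complex := chainComplexOfExact hf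
  projective n := (IsProjective.iff_projective (R := R) (P n)).1 (hP n)
  π := (ChainComplex.toSingle₀Equiv _ _).symm ⟨ModuleCat.ofHom e, by
    refine (congrArg (· ≫ ModuleCat.ofHom e) (chainComplexOfExact_d hf 0)).trans ?_
    ext x
    exact h0.le ⟨x, rfl⟩⟩
  quasiIso := ⟨fun n => by
    cases n
    · rw [ChainComplex.quasiIsoAt₀_iff, ShortComplex.quasiIso_iff_of_zeros']
      · refine (ShortComplex.exact_and_epi_g_iff_of_iso
          (S₂ := ShortComplex.mk (ModuleCat.ofHom (f 0)) (ModuleCat.ofHom e)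
            (by ext x; exact h0.le ⟨x, rfl⟩)) ?_).2
          ⟨(ShortComplex.moduleCat_exact_iff_range_eq_ker _).2 h0,
            (ModuleCat.epi_iff_surjective _).2 he⟩
        refine ShortComplex.isoMk (Iso.refl _) (Iso.refl _) (Iso.refl _) ?_ ?_
        · exact (Category.id_comp _).trans
            ((chainComplexOfExact_d hf 0).symm.trans (Category.comp_id _).symm)
        · refine (Category.id_comp _).trans (Eq.trans ?_ (Category.comp_id _).symm)
          exact (ChainComplex.toSingle₀Equiv_symm_apply_f_zero (C := chainComplexOfExact hf)
            (X := ModuleCat.of R M) (ModuleCat.ofHom e) _).symm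
      all_goals rfl
    · rename_i n
      rw [quasiIsoAt_iff_exactAt']
      · rw [HomologicalComplex.exactAt_iff' _ (n + 1 + 1) (n + 1) n (by simp) (by simp)]
        rw [ShortComplex.moduleCat_exact_iff_range_eq_ker]
        refine Eq.trans (congrArg (fun a => range (ModuleCat.Hom.hom a))
          (chainComplexOfExact_d hf (n + 1))) (Eq.trans (hf n) (congrArg (fun a =>
            ker (ModuleCat.Hom.hom a)) (chainComplexOfExact_d hf n)).symm)
      · apply ChainComplex.exactAt_succ_single_obj⟩

theorem exists_comp_of_ext_isZero (hP : ∀ n, Module.Projective R (P n))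
    (he : Function.Surjective e) (h0 : range (f 0) = ker e)
    (hf : ∀ n, range (f (n+1)) = ker (f n)) (N : Type u) [AddCommGroup N] [Module R N] (n : ℕ)
    (h : Limits.IsZero (((Ext ℤ (ModuleCat.{u} R) (n+1)).obj (Opposite.op (ModuleCat.of R M))).obj
      (ModuleCat.of R N)))
    (g : P (n+1) →ₗ[R] N) (hg : g ∘ₗ f (n+1) = 0) : ∃ g' : P n →ₗ[R] N, g' ∘ₗ f n = g := by
  have h' := h.of_iso ((projectiveResolutionOfExact hP he h0 hf).isoExt (R := ℤ) (n+1)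
    (ModuleCat.of R N)).symm
  rw [← HomologicalComplex.exactAt_iff_isZero_homology,
    HomologicalComplex.exactAt_iff' _ n (n+1) (n+2) (by simp) (by simp),
    ShortComplex.moduleCat_exact_iff] at h'
  obtain ⟨x, hx⟩ := h' (ModuleCat.ofHom g) (by
    refine (congrArg (· ≫ ModuleCat.ofHom g) (chainComplexOfExact_d hf (n + 1))).trans ?_
    exact congrArg ModuleCat.ofHom hg)
  refine ⟨ModuleCat.Hom.hom x, ?_⟩
  exact congrArg ModuleCat.Hom.hom ((congrArg (· ≫ x) (chainComplexOfExact_d hf n)).symm.trans hx)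
end ExtResolution

section HomologyOfComposite

variable {R : Type u} [Ring R] {P₁ P₀ M N L K : Type u} [AddCommGroup P₁] [Module R P₁]
  [AddCommGroup P₀] [Module R P₀] [AddCommGroup M] [Module R M] [AddCommGroup N] [Module R N]
  [AddCommGroup L] [Module R L] [AddCommGroup K] [Module R K]

theorem exists_comp_eq_of_ker_le (e : P₀ →ₗ[R] M) (he : Function.Surjective e)
    (h : P₀ →ₗ[R] N) (hh : ker e ≤ ker h) : ∃ g : M →ₗ[R] N, g ∘ₗ e = h := by
  refine ⟨(ker e).liftQ h hh ∘ₗ (e.quotKerEquivOfSurjective he).symm, ?_⟩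
  ext x
  have : (e.quotKerEquivOfSurjective he).symm (e x) = Submodule.Quotient.mk x := by
    rw [LinearEquiv.symm_apply_eq]; rfl
  simp [this]

theorem nonempty_homology_equiv_ker (a : P₁ →ₗ[R] P₀) (e : P₀ →ₗ[R] M)
    (he : Function.Surjective e) (hae : range a = ker e) (φ : M →ₗ[R] N) (i : N →ₗ[R] L)
    (hi : Function.Injective i) :
    Nonempty ((↥(ker (i ∘ₗ φ ∘ₗ e)) ⧸
      Submodule.comap (ker (i ∘ₗ φ ∘ₗ e)).subtype (range a)) ≃ₗ[R] ker φ) := by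
  have hker : ∀ x, x ∈ ker (i ∘ₗ φ ∘ₗ e) ↔ e x ∈ ker φ := fun x => by
    simp [map_eq_zero_iff i hi]
  let r : ker (i ∘ₗ φ ∘ₗ e) →ₗ[R] ker φ := e.restrict fun x hx => (hker x).1 hx
  have hr : Function.Surjective r := by
    rintro ⟨m, hm⟩
    obtain ⟨x, rfl⟩ := he m
    exact ⟨⟨x, (hker x).2 hm⟩, rfl⟩
  have hk : Submodule.comap (ker (i ∘ₗ φ ∘ₗ e)).subtype (range a) = ker r := by
    ext x
    rw [hae]
    simp [r, Subtype.ext_iff]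
  exact ⟨(Submodule.quotEquivOfEq _ _ hk).trans (r.quotKerEquivOfSurjective hr)⟩

theorem nonempty_homology_equiv_coker (e : P₀ →ₗ[R] M)
    (he : Function.Surjective e) (φ : M →ₗ[R] N) (i : N →ₗ[R] L)
    (hi : Function.Injective i) (b : L →ₗ[R] K) (hib : range i = ker b) :
    Nonempty ((↥(ker b) ⧸
      Submodule.comap (ker b).subtype (range (i ∘ₗ φ ∘ₗ e))) ≃ₗ[R] N ⧸ range φ) := by
  let t : N ≃ₗ[R] ker b := (LinearEquiv.ofInjective i hi).trans (LinearEquiv.ofEq _ _ hib)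
  have ht : ∀ n, (t n : L) = i n := fun n => rfl
  refine ⟨(Submodule.Quotient.equiv _ _ t ?_).symm⟩
  ext x
  constructor
  · rintro ⟨_, ⟨m, rfl⟩, rfl⟩
    obtain ⟨y, rfl⟩ := he m
    exact ⟨y, rfl⟩
  · rintro ⟨y, hy⟩
    exact ⟨φ (e y), ⟨e y, rfl⟩, Subtype.ext hy⟩

end HomologyOfComposite

section Duals

variable {A : Type u} [Ring A]

theorem range_dualMapL_eq_ker {P₁ P₀ M : Type u} [AddCommGroup P₁] [Module A P₁]
    [AddCommGroup P₀] [Module A P₀] [AddCommGroup M] [Module A M] (f : P₁ →ₗ[A] P₀)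
    (e : P₀ →ₗ[A] M) (he : Function.Surjective e) (hfe : range f = ker e) :
    range (dualMapL e) = ker (dualMapL f) := by
  ext h
  constructor
  · rintro ⟨g, rfl⟩
    ext x
    have hx : e (f x) = 0 := hfe.le ⟨x, rfl⟩
    simp [dualMapL, hx]
  · intro hh
    refine exists_comp_eq_of_ker_le e he h ?_
    rw [← hfe]
    rintro _ ⟨x, rfl⟩
    exact LinearMap.congr_fun (mem_ker.1 hh) x

theorem range_dualMapR_eq_ker {Q₁ Q₀ N : Type u} [AddCommGroup Q₁] [Module Aᵐᵒᵖ Q₁]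
    [AddCommGroup Q₀] [Module Aᵐᵒᵖ Q₀] [AddCommGroup N] [Module Aᵐᵒᵖ N] (d : Q₁ →ₗ[Aᵐᵒᵖ] Q₀)
    (q : Q₀ →ₗ[Aᵐᵒᵖ] N) (hq : Function.Surjective q) (hdq : range d = ker q) :
    range (dualMapR q) = ker (dualMapR d) := by
  ext h
  constructor
  · rintro ⟨g, rfl⟩
    ext x
    have hx : q (d x) = 0 := hdq.le ⟨x, rfl⟩
    simp [dualMapR, hx]
  · intro hh
    refine exists_comp_eq_of_ker_le q hq h ?_
    rw [← hdq]
    rintro _ ⟨x, rfl⟩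
    exact LinearMap.congr_fun (mem_ker.1 hh) x

theorem dualMapR_injective {Q N : Type u} [AddCommGroup Q] [Module Aᵐᵒᵖ Q]
    [AddCommGroup N] [Module Aᵐᵒᵖ N] (q : Q →ₗ[Aᵐᵒᵖ] N) (hq : Function.Surjective q) :
    Function.Injective (dualMapR q) := fun g h hgh => by
  ext y
  obtain ⟨x, rfl⟩ := hq y
  exact LinearMap.congr_fun hgh x

theorem sum_apply_smul_dualBasisR {N : Type u} [AddCommGroup N] [Module Aᵐᵒᵖ N] {n : ℕ}
    {x : Fin n → N} {ξ : Fin n → Dr A N}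
    (hx : ∀ y, ∑ i, MulOpposite.op (ξ i y) • x i = y) (h : Dr A N) :
    ∑ i, h (x i) • ξ i = h := by
  ext y
  conv_rhs => rw [← hx y]
  simp [LinearMap.sum_apply]

section Projective

variable (N : Type u) [AddCommGroup N] [Module Aᵐᵒᵖ N] [Module.Projective Aᵐᵒᵖ N]
  [Module.Finite Aᵐᵒᵖ N]

theorem exists_dualBasisR : ∃ (n : ℕ) (x : Fin n → N) (ξ : Fin n → Dr A N),
    ∀ y, ∑ i, MulOpposite.op (ξ i y) • x i = y := by
  obtain ⟨n, g, hg⟩ := Module.Finite.exists_fin' Aᵐᵒᵖ N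
  obtain ⟨s, hs⟩ := g.exists_rightInverse_of_surjective (range_eq_top.2 hg)
  refine ⟨n, fun i => g (Pi.single i 1), fun i =>
    { toFun := fun y => (s y i).unop
      map_add' := fun y z => by simp
      map_smul' := fun a y => by simp }, fun y => ?_⟩
  refine Eq.trans ?_ ((congrArg g (Finset.univ_sum_single (s y))).trans (LinearMap.congr_fun hs y))
  rw [map_sum]
  refine Finset.sum_congr rfl fun i _ => ?_
  rw [← map_smul]
  congr 1
  ext j
  by_cases hj : j = i
  · subst hj; simp
  · simp [hj]

theorem finite_projective_Dr : Module.Projective A (Dr A N) ∧ Module.Finite A (Dr A N) := by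
  obtain ⟨n, x, ξ, hx⟩ := exists_dualBasisR (A := A) N
  let i : Dr A N →ₗ[A] Fin n → A :=
    { toFun := fun h j => h (x j)
      map_add' := fun g h => rfl
      map_smul' := fun a h => rfl }
  have hi : Fintype.linearCombination A ξ ∘ₗ i = LinearMap.id :=
    LinearMap.ext fun h => sum_apply_smul_dualBasisR hx h
  exact ⟨Module.Projective.of_split i _ hi,
    Module.Finite.of_surjective (Fintype.linearCombination A ξ) fun h =>
      ⟨i h, LinearMap.congr_fun hi h⟩⟩

theorem evalR_bijective : Function.Bijective (evalR A N) := by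
  obtain ⟨n, x, ξ, hx⟩ := exists_dualBasisR (A := A) N
  constructor
  · rw [← ker_eq_bot, ker_eq_bot']
    intro y hy
    rw [← hx y]
    refine Finset.sum_eq_zero fun i _ => ?_
    rw [show ξ i y = 0 from LinearMap.congr_fun hy (ξ i)]
    simp
  · intro η
    refine ⟨∑ i, MulOpposite.op (η (ξ i)) • x i, ?_⟩
    ext h
    conv_rhs => rw [← sum_apply_smul_dualBasisR hx h]
    simp [evalR]

variable {N} in
theorem mem_radM_Dr_of_forall_mem_jacobson (h : Dr A N) (hh : ∀ y, h y ∈ Ring.jacobson A) :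
    h ∈ radM A (Dr A N) := by
  obtain ⟨n, x, ξ, hx⟩ := exists_dualBasisR (A := A) N
  rw [← sum_apply_smul_dualBasisR hx h]
  exact sum_mem fun i _ => Ring.jacobson_smul_top_le A _
    (Submodule.smul_mem_smul (hh _) Submodule.mem_top)

end Projective

section Bidual

variable {Q₁ Q₀ : Type u} [AddCommGroup Q₁] [Module Aᵐᵒᵖ Q₁] [AddCommGroup Q₀] [Module Aᵐᵒᵖ Q₀]
  {M : Type u} [AddCommGroup M] [Module A M] {P : Type u} [AddCommGroup P] [Module A P]

theorem range_dualMapL_dualMapR [Module.Projective Aᵐᵒᵖ Q₁] [Module.Finite Aᵐᵒᵖ Q₁]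
    (d : Q₁ →ₗ[Aᵐᵒᵖ] Q₀) :
    range (dualMapL (dualMapR d)) = (range d).map (evalR A Q₀) := by
  rw [← range_comp, show evalR A Q₀ ∘ₗ d = dualMapL (dualMapR d) ∘ₗ evalR A Q₁ from rfl,
    range_comp_of_range_eq_top _ (range_eq_top.2 (evalR_bijective Q₁).2)]

theorem map_evalR_ker [Module.Projective Aᵐᵒᵖ Q₁] [Module.Finite Aᵐᵒᵖ Q₁]
    (d : Q₁ →ₗ[Aᵐᵒᵖ] Q₀) (g : Dl A (Dr A Q₁) →ₗ[Aᵐᵒᵖ] Q₀)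
    (h : g ∘ₗ evalR A Q₁ = d) :
    (ker d).map (evalR A Q₁) = ker g := by
  rw [← h, ker_comp, Submodule.map_comap_eq_of_surjective (evalR_bijective Q₁).2]

theorem range_dualMapL_dualMapR_eq_ker_of_exact {Q₂ : Type u} [AddCommGroup Q₂] [Module Aᵐᵒᵖ Q₂]
    [Module.Projective Aᵐᵒᵖ Q₂] [Module.Finite Aᵐᵒᵖ Q₂]
    [Module.Projective Aᵐᵒᵖ Q₁] [Module.Finite Aᵐᵒᵖ Q₁]
    [Module.Projective Aᵐᵒᵖ Q₀] [Module.Finite Aᵐᵒᵖ Q₀]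
    (d₁ : Q₂ →ₗ[Aᵐᵒᵖ] Q₁) (d₀ : Q₁ →ₗ[Aᵐᵒᵖ] Q₀) (h : range d₁ = ker d₀) :
    range (dualMapL (dualMapR d₁)) = ker (dualMapL (dualMapR d₀)) := by
  rw [range_dualMapL_dualMapR, h,
    ← ker_comp_of_ker_eq_bot d₀ (ker_eq_bot.2 (evalR_bijective (A := A) Q₀).1)]
  exact map_evalR_ker _ _ rfl

theorem dualMapL_connecting_comp_evalR (q : Q₀ →ₗ[Aᵐᵒᵖ] Dl A M) (e : P →ₗ[A] M) :
    dualMapL (dualMapR q ∘ₗ evalL A M ∘ₗ e) ∘ₗ evalR A Q₀ = dualMapL e ∘ₗ q := rfl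

theorem dualMapL_injective (e : P →ₗ[A] M) (he : Function.Surjective e) :
    Function.Injective (dualMapL e) := fun g h hgh => by
  ext y
  obtain ⟨x, rfl⟩ := he y
  exact LinearMap.congr_fun hgh x

variable [Module.Projective Aᵐᵒᵖ Q₀] [Module.Finite Aᵐᵒᵖ Q₀]

theorem range_dualMapL_connecting (q : Q₀ →ₗ[Aᵐᵒᵖ] Dl A M) (hq : Function.Surjective q)
    (e : P →ₗ[A] M) :
    range (dualMapL (dualMapR q ∘ₗ evalL A M ∘ₗ e)) = range (dualMapL e) := by
  rw [← range_comp_of_range_eq_top _ (range_eq_top.2 (evalR_bijective (A := A) Q₀).2),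
    dualMapL_connecting_comp_evalR, range_comp_of_range_eq_top _ (range_eq_top.2 hq)]

variable [Module.Projective Aᵐᵒᵖ Q₁] [Module.Finite Aᵐᵒᵖ Q₁]

theorem range_dualMapL_dualMapR_eq_ker_connecting (d : Q₁ →ₗ[Aᵐᵒᵖ] Q₀) (q : Q₀ →ₗ[Aᵐᵒᵖ] Dl A M)
    (hdq : range d = ker q) (e : P →ₗ[A] M) (he : Function.Surjective e) :
    range (dualMapL (dualMapR d)) = ker (dualMapL (dualMapR q ∘ₗ evalL A M ∘ₗ e)) := by
  rw [range_dualMapL_dualMapR, hdq,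
    ← ker_comp_of_ker_eq_bot q (ker_eq_bot.2 (dualMapL_injective e he))]
  exact map_evalR_ker _ _ (dualMapL_connecting_comp_evalR q e)

theorem nonempty_coker_bidual_equiv {N : Type u} [AddCommGroup N] [Module Aᵐᵒᵖ N]
    (d : Q₁ →ₗ[Aᵐᵒᵖ] Q₀) (q : Q₀ →ₗ[Aᵐᵒᵖ] N) (hq : Function.Surjective q)
    (hdq : range d = ker q) :
    Nonempty ((Dl A (Dr A Q₀) ⧸ range (dualMapL (dualMapR d))) ≃ₗ[Aᵐᵒᵖ] N) := by
  have h : (ker q).map (LinearEquiv.ofBijective (evalR A Q₀) (evalR_bijective Q₀)).toLinearMap =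
      range (dualMapL (dualMapR d)) := by
    rw [range_dualMapL_dualMapR, hdq]
    rfl
  exact ⟨(Submodule.Quotient.equiv _ _ _ h).symm.trans (q.quotKerEquivOfSurjective hq)⟩

end Bidual

section SemiGorensteinProjective

theorem range_dualMapL_eq_ker_of_sGp {M : Type u} [AddCommGroup M] [Module A M]
    (hM : sGp A M) {P : ℕ → Type u} [∀ n, AddCommGroup (P n)] [∀ n, Module A (P n)]
    {f : ∀ n, P (n+1) →ₗ[A] P n} {e : P 0 →ₗ[A] M} (hP : ∀ n, Module.Projective A (P n))
    (he : Function.Surjective e) (hfe : range (f 0) = ker e)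
    (hf : ∀ n, range (f (n+1)) = ker (f n)) (n : ℕ) :
    range (dualMapL (f n)) = ker (dualMapL (f (n + 1))) := by
  ext g
  constructor
  · rintro ⟨h, rfl⟩
    exact congrArg h.comp (range_le_ker_iff.1 (hf n).le) |>.trans (comp_zero h)
  · exact exists_comp_of_ext_isZero hP he hfe hf A n (hM (n + 1) n.succ_pos) g

theorem range_dualMapR_eq_ker_of_sGpR {N : Type u} [AddCommGroup N] [Module Aᵐᵒᵖ N]
    (hN : sGpR A N) {Q : ℕ → Type u} [∀ n, AddCommGroup (Q n)] [∀ n, Module Aᵐᵒᵖ (Q n)]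
    {d : ∀ n, Q (n+1) →ₗ[Aᵐᵒᵖ] Q n} {q : Q 0 →ₗ[Aᵐᵒᵖ] N}
    (hQ : ∀ n, Module.Projective Aᵐᵒᵖ (Q n))
    (hq : Function.Surjective q) (hdq : range (d 0) = ker q)
    (hd : ∀ n, range (d (n+1)) = ker (d n)) (n : ℕ) :
    range (dualMapR (d n)) = ker (dualMapR (d (n + 1))) := by
  ext g
  constructor
  · rintro ⟨h, rfl⟩
    exact congrArg h.comp (range_le_ker_iff.1 (hd n).le) |>.trans (comp_zero h)
  · exact exists_comp_of_ext_isZero hQ hq hdq hd A n (hN (n + 1) n.succ_pos) g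

end SemiGorensteinProjective

theorem mem_jacobson_of_forall_isNilpotent_mul (a : A) (h : ∀ b, IsNilpotent (b * a)) :
    a ∈ Ring.jacobson A := by
  rw [← Ideal.jacobson_bot, Ideal.mem_jacobson_iff]
  intro y
  obtain ⟨z, hz⟩ := (h y).isUnit_one_add.exists_left_inv
  refine ⟨z, ?_⟩
  rw [Ideal.mem_bot, ← hz]
  noncomm_ring

theorem apply_mem_jacobson_of_mem_radM [IsArtinianRing Aᵐᵒᵖ] {N : Type u} [AddCommGroup N]
    [Module Aᵐᵒᵖ N] (h : Dr A N) {y : N} (hy : y ∈ radM Aᵐᵒᵖ N) : h y ∈ Ring.jacobson A := by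
  let g : N →ₗ[Aᵐᵒᵖ] Aᵐᵒᵖ :=
    { toFun := fun y => MulOpposite.op (h y)
      map_add' := fun y z => by simp
      map_smul' := fun a y => by simp }
  have hg : g y ∈ Ring.jacobson Aᵐᵒᵖ := Module.le_comap_jacobson g hy
  obtain ⟨n, hn⟩ := IsSemiprimaryRing.isNilpotent (R := Aᵐᵒᵖ)
  refine mem_jacobson_of_forall_isNilpotent_mul _ fun b => ⟨n, ?_⟩
  have hb : g y * MulOpposite.op b ∈ Ring.jacobson Aᵐᵒᵖ := Ideal.mul_mem_right _ _ hg
  have hpow := Ideal.pow_mem_pow hb n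
  rw [hn] at hpow
  exact congrArg MulOpposite.unop hpow

theorem exists_isIdempotentElem_mul [IsArtinianRing A] (a : A) (ha : ¬ IsNilpotent a) :
    ∃ b, IsIdempotentElem (b * a) ∧ b * a ≠ 0 := by
  have : IsNoetherianRing A := inferInstance
  let ρ : Module.End A A := LinearMap.toSpanSingleton A A a
  have hρ : ∀ n x, (ρ ^ n) x = x * a ^ n := by
    intro n
    induction n with
    | zero => simp
    | succ n ih => intro x; rw [pow_succ', Module.End.mul_apply, ih]; simp [ρ, mul_assoc, pow_succ]
  obtain ⟨n, hc, hn⟩ := (ρ.eventually_isCompl_ker_pow_range_pow.and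
    (Filter.eventually_ge_atTop 1)).exists
  obtain ⟨κ, ε, hκ, hε, h1⟩ := Submodule.codisjoint_iff_exists_add_eq.1 hc.codisjoint 1
  obtain ⟨x, rfl⟩ := hε
  obtain ⟨n, rfl⟩ : ∃ m, n = m + 1 := ⟨n - 1, by omega⟩
  have hεa : (ρ ^ (n + 1)) x = (x * a ^ n) * a := by rw [hρ, pow_succ, mul_assoc]
  refine ⟨x * a ^ n, ?_, fun h0 => ha ?_⟩
  · rw [← hεa]
    set ε := (ρ ^ (n + 1)) x with hε
    have hmem : ε * κ = ε - ε * ε := by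
      rw [eq_sub_iff_add_eq, ← mul_add, h1, mul_one]
    have hz : ε * κ = 0 := by
      refine Submodule.disjoint_def.1 hc.disjoint _ (Submodule.smul_mem _ ε hκ) ?_
      rw [hmem]
      exact sub_mem ⟨x, rfl⟩ (Submodule.smul_mem _ ε ⟨x, rfl⟩)
    exact (sub_eq_zero.1 (hmem.symm.trans hz)).symm
  · rw [hεa, h0, add_zero] at h1
    refine ⟨n + 1, ?_⟩
    rw [← one_mul (a ^ (n+1)), ← hρ, ← h1]
    exact hκ

theorem Reduced.apply_mem_jacobson [IsArtinianRing A] {M : Type u} [AddCommGroup M] [Module A M]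
    (hM : Reduced A M) (g : Dl A M) (m : M) : g m ∈ Ring.jacobson A := by
  refine mem_jacobson_of_forall_isNilpotent_mul _ fun b => ?_
  by_contra hnil
  obtain ⟨c, hid, hne⟩ := exists_isIdempotentElem_mul _ hnil
  rw [← mul_assoc] at hid hne
  obtain ⟨m', hm'⟩ : ∃ m', g m' = c * b * g m := ⟨(c * b) • m, by simp⟩
  rw [← hm'] at hid hne
  let s : A →ₗ[A] M := LinearMap.toSpanSingleton A M (g m' • m')
  let p : M →ₗ[A] M := s ∘ₗ g
  have hp : ∀ x, p x = (g x * g m') • m' := fun x => by simp [p, s, mul_smul]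
  have hgp : ∀ x, g (p x) = g x * g m' := fun x => by
    rw [hp, map_smul, smul_eq_mul, mul_assoc, hid.eq]
  have hpp : IsIdempotentElem p := by
    ext x
    rw [Module.End.mul_apply, hp, hgp, mul_assoc, hid.eq, hp]
  have hproj : Module.Projective A (range p) := by
    refine Module.Projective.of_split (g ∘ₗ (range p).subtype)
      (p.rangeRestrict ∘ₗ LinearMap.toSpanSingleton A M m') ?_
    ext ⟨_, x, rfl⟩
    simp [hp, mul_assoc, hid.eq]
  have hbot := hM (range p) (ker p) (LinearMap.IsIdempotentElem.isCompl hpp) hproj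
  have h0 : p m' = 0 := by
    rw [← Submodule.mem_bot A, ← hbot]
    exact ⟨m', rfl⟩
  have := hgp m'
  rw [h0, map_zero, hid.eq] at this
  exact hne this.symm

end Duals

section GluedInduction

variable {A : Type u} [Ring A]
  {P : ℕ → Type u} [∀ n, AddCommGroup (P n)] [∀ n, Module A (P n)]
  {Q : ℕ → Type u} [∀ n, AddCommGroup (Q n)] [∀ n, Module Aᵐᵒᵖ (Q n)]
  {M : Type u} [AddCommGroup M] [Module A M]
  {f : ∀ n, P (n+1) →ₗ[A] P n} {e : P 0 →ₗ[A] M}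
  {d : ∀ n, Q (n+1) →ₗ[Aᵐᵒᵖ] Q n} {q : Q 0 →ₗ[Aᵐᵒᵖ] Dl A M}

/-- A property of the uncast differential `gluedF0` also holds for `gluedF`. -/
theorem gluedF_of_gluedF0 (C : ∀ i j, (gluedP A P Q i →ₗ[A] gluedP A P Q j) → Prop) (i : ℤ)
    (h : C i (predZ i) (gluedF0 A P Q f e d q i)) : C i (i - 1) (gluedF A P Q f e d q i) := by
  unfold gluedF
  generalize_proofs h1
  revert h1
  rw [← predZ_eq i]
  exact fun _ => h

/-- A property of two consecutive uncast differentials also holds for those of `gluedF`. -/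
theorem gluedF_pair_of_gluedF0 (C : ∀ i j k, (gluedP A P Q i →ₗ[A] gluedP A P Q j) →
      (gluedP A P Q j →ₗ[A] gluedP A P Q k) → Prop) (i : ℤ)
    (h : C i (predZ i) (predZ (predZ i)) (gluedF0 A P Q f e d q i)
      (gluedF0 A P Q f e d q (predZ i))) :
    C i (i - 1) (i - 1 - 1) (gluedF A P Q f e d q i) (gluedF A P Q f e d q (i - 1)) := by
  have h' := gluedF_of_gluedF0 (f := f) (e := e) (d := d) (q := q)
    (fun j k b => ∀ hj : predZ i = j, C i j k (cast (by rw [hj]) (gluedF0 A P Q f e d q i)) b)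
    (i - 1) (by rw [← predZ_eq i]; exact fun _ => h) (predZ_eq i)
  exact h'

end GluedInduction

/-- Theorem 2.1 (first half): gluing the minimal projective resolutions of `M` and of `M^*`
along `f₀ = q^* ∘ φ_M ∘ e` yields a minimal complex of projective modules, exact away
from positions `0, -1`, with `H₀ ≅ Ker φ_M`, `H₋₁ ≅ Cok φ_M`, acyclic `A`-dual complex,
`M ≅ Cok f₁` and `M^* ≅ Cok f₋₁^*`. -/
theorem glued_complex_of_both_sgp (k : Type u) [CommRing k] [IsArtinianRing k]
    (A : Type u) [Ring A] [Algebra k A] [Module.Finite k A]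
    (M : Type u) [AddCommGroup M] [Module A M] [Module.Finite A M]
    (hred : Reduced A M) (hsgp : sGp A M) (hsgpdual : sGpR A (Dl A M))
    (P : ℕ → Type u) [∀ n, AddCommGroup (P n)] [∀ n, Module A (P n)]
    (f : ∀ n, P (n+1) →ₗ[A] P n) (e : P 0 →ₗ[A] M) (hres : IsMinProjRes A P f e)
    (Q : ℕ → Type u) [∀ n, AddCommGroup (Q n)] [∀ n, Module Aᵐᵒᵖ (Q n)]
    (d : ∀ n, Q (n+1) →ₗ[Aᵐᵒᵖ] Q n) (q : Q 0 →ₗ[Aᵐᵒᵖ] Dl A M)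
    (hres' : IsMinProjRes Aᵐᵒᵖ Q d q) :
    IsComplexZ A (gluedP A P Q) (gluedF A P Q f e d q) ∧
    IsMinimalZ A (gluedP A P Q) (gluedF A P Q f e d q) ∧
    IsProjComplexZ A (gluedP A P Q) ∧
    (∀ i : ℤ, i ≠ 0 → i ≠ 1 → ExactAtPred A (gluedP A P Q) (gluedF A P Q f e d q) i) ∧
    DualAcyclicZ A (gluedP A P Q) (gluedF A P Q f e d q) ∧
    Nonempty ((HomologyAtPred A (gluedP A P Q) (gluedF A P Q f e d q) 1) ≃ₗ[A]
      ↥(ker (evalL A M))) ∧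
    Nonempty ((HomologyAtPred A (gluedP A P Q) (gluedF A P Q f e d q) 0) ≃ₗ[A]
      ((Dr A (Dl A M)) ⧸ range (evalL A M))) ∧
    Nonempty ((P 0 ⧸ range (gluedF A P Q f e d q 1)) ≃ₗ[A] M) ∧
    Nonempty (((Dl A (gluedP A P Q (-1))) ⧸
        range (dualMapL (gluedF A P Q f e d q (-1)))) ≃ₗ[Aᵐᵒᵖ] Dl A M) := by
  have : IsArtinianRing A := .of_finite k A
  have : IsArtinianRing Aᵐᵒᵖ := .of_finite k Aᵐᵒᵖ
  obtain ⟨hP, hPfin, he, hfe, hff, hke, hkf⟩ := hres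
  obtain ⟨hQ, hQfin, hq, hdq, hdd, hkq, hkd⟩ := hres'
  have hL : ∀ n, range (dualMapL (f n)) = ker (dualMapL (f (n + 1))) :=
    range_dualMapL_eq_ker_of_sGp hsgp hP he hfe hff
  have hR : ∀ n, range (dualMapR (d n)) = ker (dualMapR (d (n + 1))) :=
    range_dualMapR_eq_ker_of_sGpR hsgpdual hQ hq hdq hdd
  have hdqR : range (dualMapR q) = ker (dualMapR (d 0)) := range_dualMapR_eq_ker _ _ hq hdq
  have hqinj : Function.Injective (dualMapR q) := dualMapR_injective q hq
  have hdcomp : ∀ n, d n ∘ₗ d (n + 1) = 0 := fun n => range_le_ker_iff.1 (hdd n).le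
  have hrad : ∀ n, range (d n) ≤ radM Aᵐᵒᵖ (Q n)
    | 0 => hdq.le.trans hkq
    | n + 1 => (hdd n).le.trans (hkd n)
  refine ⟨fun i => ?_, fun i => ?_, fun i => ?_, fun i h0 h1 => ?_, fun i => ?_, ?_, ?_, ?_, ?_⟩
  · refine gluedF_pair_of_gluedF0 (fun _ _ _ a b => b ∘ₗ a = 0) i ?_
    match i with
    | .ofNat 0 =>
      refine range_le_ker_iff.1 ?_
      rintro _ ⟨x, rfl⟩
      exact hdqR.le ⟨_, rfl⟩
    | .ofNat 1 =>
      ext x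
      have hx : e (f 0 x) = 0 := hfe.le ⟨x, rfl⟩
      change dualMapR q (evalL A M (e (f 0 x))) = 0
      rw [hx, map_zero, map_zero]
    | .ofNat (n + 2) => exact range_le_ker_iff.1 (hff n).le
    | .negSucc n => exact range_le_ker_iff.1 (hR n).le
  · refine gluedF_of_gluedF0 (fun _ j a => range a ≤ radM A (gluedP A P Q j)) i ?_
    match i with
    | .ofNat 0 =>
      rintro _ ⟨x, rfl⟩
      have := hQ 0
      have := hQfin 0
      exact mem_radM_Dr_of_forall_mem_jacobson (A := A) (N := Q 0) _
        fun y => hred.apply_mem_jacobson (q y) (e x)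
    | .ofNat 1 => exact hfe.le.trans hke
    | .ofNat (n + 2) => exact (hff n).le.trans (hkf n)
    | .negSucc n =>
      rintro _ ⟨h, rfl⟩
      have := hQ (n + 1)
      have := hQfin (n + 1)
      exact mem_radM_Dr_of_forall_mem_jacobson (A := A) (N := Q (n + 1)) _
        fun y => apply_mem_jacobson_of_mem_radM (A := A) (N := Q n) h (hrad n ⟨y, rfl⟩)
  · match i with
    | .ofNat n => exact ⟨hP n, hPfin n⟩
    | .negSucc n =>
      have := hQ n
      have := hQfin n
      exact finite_projective_Dr (Q n)
  · refine gluedF_pair_of_gluedF0 (fun _ _ _ a b => range a = ker b) i ?_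
    match i with
    | .ofNat 0 => exact absurd rfl h0
    | .ofNat 1 => exact absurd rfl h1
    | .ofNat (n + 2) => exact hff n
    | .negSucc n => exact hR n
  · refine gluedF_pair_of_gluedF0
      (fun _ _ _ a b => range (dualMapL b) = ker (dualMapL a)) i ?_
    match i with
    | .ofNat 0 =>
      have := hQ 0
      have := hQfin 0
      have := hQ 1
      have := hQfin 1
      exact range_dualMapL_dualMapR_eq_ker_connecting (d 0) q hdq e he
    | .ofNat 1 =>
      have := hQ 0
      have := hQfin 0
      exact (range_dualMapL_connecting q hq e).trans (range_dualMapL_eq_ker _ _ he hfe)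
    | .ofNat (n + 2) => exact hL n
    | .negSucc n =>
      have := hQ n
      have := hQfin n
      have := hQ (n + 1)
      have := hQfin (n + 1)
      have := hQ (n + 2)
      have := hQfin (n + 2)
      exact range_dualMapL_dualMapR_eq_ker_of_exact _ _ (hdd n)
  · refine gluedF_pair_of_gluedF0
      (fun _ _ _ a b => Nonempty ((↥(ker b) ⧸ Submodule.comap (ker b).subtype (range a)) ≃ₗ[A]
        ↥(ker (evalL A M)))) 1 ?_
    exact nonempty_homology_equiv_ker (f 0) e he hfe (evalL A M) (dualMapR q) hqinj
  · refine gluedF_pair_of_gluedF0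
      (fun _ _ _ a b => Nonempty ((↥(ker b) ⧸ Submodule.comap (ker b).subtype (range a)) ≃ₗ[A]
        (Dr A (Dl A M)) ⧸ range (evalL A M))) 0 ?_
    exact nonempty_homology_equiv_coker e he (evalL A M) (dualMapR q) hqinj (dualMapR (d 0)) hdqR
  · exact ⟨(Submodule.quotEquivOfEq _ _ hfe).trans (e.quotKerEquivOfSurjective he)⟩
  · refine gluedF_of_gluedF0
      (fun i j (a : gluedP A P Q i →ₗ[A] gluedP A P Q j) =>
        Nonempty ((Dl A (gluedP A P Q i) ⧸ range (dualMapL a)) ≃ₗ[Aᵐᵒᵖ] Dl A M)) (-1) ?_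
    have := hQ 0
    have := hQfin 0
    have := hQ 1
    have := hQfin 1
    exact nonempty_coker_bidual_equiv (d 0) q hq hdq
end

section
/- Let Q₋₂ ←d₋₁ Q₋₁ ←d₀ Q₀ ←d₁ Q₁ be a sequence of finitely generated projective right A-modules with d₋₁∘d₀ = 0 and d₀∘d₁ = 0. Let e : Q₋₁* → M be a cokernel of d₋₁* : Q₋₂* → Q₋₁*, and let c : Q₀ → N be a cokernel of d₁. Then the following are equivalent: (i) the sequence is exact (at Q₋₁ and at Q₀); (ii) there exists an isomorphism ζ : N → M* such that d₀* = c* ∘ ζ* ∘ φ_M ∘ e. Moreover, if (ii) holds, then q = ζ∘c : Q₀ → M* is a cokernel of d₁, d₀ = e* ∘ q, and d₀* = q* ∘ φ_M ∘ e. -/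
/-!
Common background: `A` is an artin algebra (an algebra over a commutative artinian
ring `k`, finitely generated as `k`-module).  Left `A`-modules are `Module A M`;
right `A`-modules are `Module Aᵐᵒᵖ N`.  `Dl A M = Hom_A(M,A)` is the `A`-dual of a
left module (a right module) and `Dr A N` the dual of a right module (a left module);
`evalL A M : M → M**` is the canonical evaluation map `φ_M`.
-/

open CategoryTheory LinearMap

universe u

/-- A surjection `c` and an injection `v` that, through `u`, have the same kernel and image
respectively are linked by an isomorphism. -/
lemma exists_linearEquiv_comp_eq {R X Y V W : Type*} [Ring R]
    [AddCommGroup X] [Module R X] [AddCommGroup Y] [Module R Y]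
    [AddCommGroup V] [Module R V] [AddCommGroup W] [Module R W]
    (c : X →ₗ[R] Y) (u : X →ₗ[R] W) (v : V →ₗ[R] W)
    (hc : Function.Surjective c) (hv : Function.Injective v)
    (hker : ker c = ker u) (hrange : range u = range v) :
    ∃ ζ : Y ≃ₗ[R] V, ∀ x, v (ζ (c x)) = u x := by
  refine ⟨(c.quotKerEquivOfSurjective hc).symm ≪≫ₗ Submodule.quotEquivOfEq _ _ hker ≪≫ₗ
    u.quotKerEquivRange ≪≫ₗ LinearEquiv.ofEq _ _ hrange ≪≫ₗ (LinearEquiv.ofInjective v hv).symm,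
    fun x => ?_⟩
  have h₁ : (c.quotKerEquivOfSurjective hc).symm (c x) = Submodule.Quotient.mk x := by
    rw [LinearEquiv.symm_apply_eq]
    rfl
  simp only [LinearEquiv.trans_apply, h₁]
  rw [← LinearEquiv.ofInjective_apply (h := hv), LinearEquiv.apply_symm_apply]
  rfl

/-- The dual basis lemma for finitely generated projective right modules. -/
lemma exists_dual_basis (A : Type u) [Ring A] (P : Type u) [AddCommGroup P] [Module Aᵐᵒᵖ P]
    [Module.Projective Aᵐᵒᵖ P] [Module.Finite Aᵐᵒᵖ P] :
    ∃ (n : ℕ) (p : Fin n → P) (f : Fin n → Dr A P),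
      ∀ x, x = ∑ i, MulOpposite.op (f i x) • p i := by
  obtain ⟨n, g, hg⟩ := Module.Finite.exists_fin' Aᵐᵒᵖ P
  obtain ⟨s, hs⟩ := Module.projective_lifting_property g LinearMap.id hg
  refine ⟨n, fun i => g (Pi.single i 1), fun i =>
    { toFun := fun x => (s x i).unop
      map_add' := by simp
      map_smul' := by simp }, fun x => ?_⟩
  have hx : g (s x) = x := LinearMap.congr_fun hs x
  conv_lhs => rw [← hx, pi_eq_sum_univ' (s x), map_sum]
  refine Finset.sum_congr rfl fun i _ => ?_
  rw [map_smul]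
  congr 2

lemma evalR_injective (A : Type u) [Ring A] (P : Type u) [AddCommGroup P] [Module Aᵐᵒᵖ P]
    [Module.Projective Aᵐᵒᵖ P] [Module.Finite Aᵐᵒᵖ P] : Function.Injective (evalR A P) := by
  obtain ⟨n, p, f, hpf⟩ := exists_dual_basis A P
  intro x y hxy
  rw [hpf x, hpf y]
  refine Finset.sum_congr rfl fun i _ => ?_
  have h : f i x = f i y := LinearMap.congr_fun hxy (f i)
  rw [h]

lemma evalR_surjective (A : Type u) [Ring A] (P : Type u) [AddCommGroup P] [Module Aᵐᵒᵖ P]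
    [Module.Projective Aᵐᵒᵖ P] [Module.Finite Aᵐᵒᵖ P] : Function.Surjective (evalR A P) := by
  obtain ⟨n, p, f, hpf⟩ := exists_dual_basis A P
  intro F
  refine ⟨∑ i, MulOpposite.op (F (f i)) • p i, LinearMap.ext fun h => ?_⟩
  have hh : h = ∑ i, h (p i) • f i := by
    ext x
    conv_lhs => rw [hpf x, map_sum]
    simp
  change h (∑ i, MulOpposite.op (F (f i)) • p i) = F h
  conv_rhs => rw [hh]
  simp

lemma dualMapL_injective_s2 {A M N : Type u} [Ring A] [AddCommGroup M] [Module A M]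
    [AddCommGroup N] [Module A N] {g : M →ₗ[A] N} (hg : Function.Surjective g) :
    Function.Injective (dualMapL g) := fun f f' h => by
  ext y
  obtain ⟨x, rfl⟩ := hg y
  exact LinearMap.congr_fun h x

lemma mem_range_dualMapL_iff {A M N : Type u} [Ring A] [AddCommGroup M] [Module A M]
    [AddCommGroup N] [Module A N] {g : M →ₗ[A] N} (hg : Function.Surjective g) {f : Dl A M} :
    f ∈ range (dualMapL g) ↔ ker g ≤ ker f := by
  refine ⟨?_, fun h => ?_⟩
  · rintro ⟨f', rfl⟩ x hx
    change f' (g x) = 0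
    rw [LinearMap.mem_ker.mp hx, map_zero]
  · refine ⟨(ker g).liftQ f h ∘ₗ (g.quotKerEquivOfSurjective hg).symm.toLinearMap,
      LinearMap.ext fun x => ?_⟩
    have hx : (g.quotKerEquivOfSurjective hg).symm (g x) = Submodule.Quotient.mk x := by
      rw [LinearEquiv.symm_apply_eq]
      rfl
    change (ker g).liftQ f h ((g.quotKerEquivOfSurjective hg).symm (g x)) = f x
    rw [hx, Submodule.liftQ_apply]

/-- For `e` a cokernel of `d*`, the image of `e*` corresponds to `ker d` under evaluation. -/
lemma evalR_mem_range_dualMapL_iff {A P Q M : Type u} [Ring A]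
    [AddCommGroup P] [Module Aᵐᵒᵖ P] [AddCommGroup Q] [Module Aᵐᵒᵖ Q]
    [Module.Projective Aᵐᵒᵖ Q] [Module.Finite Aᵐᵒᵖ Q] [AddCommGroup M] [Module A M]
    {d : P →ₗ[Aᵐᵒᵖ] Q} {e : Dr A P →ₗ[A] M} (he : Function.Surjective e)
    (hker : ker e = range (dualMapR d)) {x : P} :
    evalR A P x ∈ range (dualMapL e) ↔ x ∈ ker d := by
  rw [mem_range_dualMapL_iff he, hker, LinearMap.mem_ker]
  refine ⟨fun h => evalR_injective A Q ?_, fun h => ?_⟩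
  · rw [map_zero]
    exact LinearMap.ext fun g => h ⟨g, rfl⟩
  · rintro _ ⟨g, rfl⟩
    change g (d x) = 0
    rw [h, map_zero]

/-- Lemma 2.2: for a sequence `Q₋₂ ← Q₋₁ ← Q₀ ← Q₁` of projective right modules with zero
compositions, with `e : Q₋₁^* → M` a cokernel of `d₋₁^*` and `c : Q₀ → N` a cokernel of `d₁`:
the sequence is exact iff there is an isomorphism `ζ : N ≅ M^*` with
`d₀^* = c^* ∘ ζ^* ∘ φ_M ∘ e`; in that case `q = ζ∘c` is a cokernel of `d₁`,
`φ ∘ d₀ = e^* ∘ q` and `d₀^* = q^* ∘ φ_M ∘ e`. -/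
theorem exactness_iff_norm_factorization (k : Type u) [CommRing k] [IsArtinianRing k]
    (A : Type u) [Ring A] [Algebra k A] [Module.Finite k A]
    (Qm2 Qm1 Q0 Q1 : Type u)
    [AddCommGroup Qm2] [Module Aᵐᵒᵖ Qm2] [AddCommGroup Qm1] [Module Aᵐᵒᵖ Qm1]
    [AddCommGroup Q0] [Module Aᵐᵒᵖ Q0] [AddCommGroup Q1] [Module Aᵐᵒᵖ Q1]
    (hp2 : Module.Projective Aᵐᵒᵖ Qm2) (hg2 : Module.Finite Aᵐᵒᵖ Qm2)
    (hp1 : Module.Projective Aᵐᵒᵖ Qm1) (hg1 : Module.Finite Aᵐᵒᵖ Qm1)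
    (hp0 : Module.Projective Aᵐᵒᵖ Q0) (hg0 : Module.Finite Aᵐᵒᵖ Q0)
    (hpp1 : Module.Projective Aᵐᵒᵖ Q1) (hgg1 : Module.Finite Aᵐᵒᵖ Q1)
    (dm1 : Qm1 →ₗ[Aᵐᵒᵖ] Qm2) (d0 : Q0 →ₗ[Aᵐᵒᵖ] Qm1) (d1 : Q1 →ₗ[Aᵐᵒᵖ] Q0)
    (hc1 : dm1 ∘ₗ d0 = 0) (hc2 : d0 ∘ₗ d1 = 0)
    (M : Type u) [AddCommGroup M] [Module A M]
    (N : Type u) [AddCommGroup N] [Module Aᵐᵒᵖ N]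
    (e : Dr A Qm1 →ₗ[A] M) (heSurj : Function.Surjective e)
    (heKer : ker e = range (dualMapR dm1))
    (c : Q0 →ₗ[Aᵐᵒᵖ] N) (hcSurj : Function.Surjective c) (hcKer : ker c = range d1) :
    ((range d0 = ker dm1 ∧ range d1 = ker d0) ↔
      (∃ ζ : N ≃ₗ[Aᵐᵒᵖ] Dl A M,
        dualMapR d0 =
          (dualMapR c) ∘ₗ ((dualMapR ζ.toLinearMap) ∘ₗ ((evalL A M) ∘ₗ e)))) ∧
    (∀ ζ : N ≃ₗ[Aᵐᵒᵖ] Dl A M,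
      dualMapR d0 = (dualMapR c) ∘ₗ ((dualMapR ζ.toLinearMap) ∘ₗ ((evalL A M) ∘ₗ e)) →
        (Function.Surjective (ζ.toLinearMap ∘ₗ c) ∧
         ker (ζ.toLinearMap ∘ₗ c) = range d1 ∧
         (evalR A Qm1) ∘ₗ d0 = (dualMapL e) ∘ₗ (ζ.toLinearMap ∘ₗ c) ∧
         dualMapR d0 = (dualMapR (ζ.toLinearMap ∘ₗ c)) ∘ₗ ((evalL A M) ∘ₗ e))) := by
  have h_inj := evalR_injective A Qm1
  have he_inj := dualMapL_injective_s2 heSurj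
  have h_range : ∀ {x}, evalR A Qm1 x ∈ range (dualMapL e) ↔ x ∈ ker dm1 :=
    evalR_mem_range_dualMapL_iff heSurj heKer
  have h_fact : ∀ ζ : N ≃ₗ[Aᵐᵒᵖ] Dl A M,
      dualMapR d0 = (dualMapR c) ∘ₗ ((dualMapR ζ.toLinearMap) ∘ₗ ((evalL A M) ∘ₗ e)) ↔
        ∀ x, dualMapL e (ζ (c x)) = evalR A Qm1 (d0 x) := fun ζ =>
    ⟨fun h x => LinearMap.ext fun g => (LinearMap.congr_fun (LinearMap.congr_fun h g) x).symm,
      fun h => LinearMap.ext fun g => LinearMap.ext fun x =>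
        (LinearMap.congr_fun (h x) g).symm⟩
  refine ⟨⟨?_, ?_⟩, fun ζ hζ => ⟨ζ.surjective.comp hcSurj, ?_, ?_, hζ⟩⟩
  · rintro ⟨h₁, h₂⟩
    obtain ⟨ζ, hζ⟩ := exists_linearEquiv_comp_eq c (evalR A Qm1 ∘ₗ d0) (dualMapL e) hcSurj he_inj
      (by rw [hcKer, h₂, LinearMap.ker_comp_of_ker_eq_bot _ (LinearMap.ker_eq_bot.mpr h_inj)])
      (by
        ext F
        obtain ⟨x, rfl⟩ := evalR_surjective A Qm1 F
        rw [h_range, ← h₁]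
        exact exists_congr fun y => h_inj.eq_iff)
    exact ⟨ζ, (h_fact ζ).mpr hζ⟩
  · rintro ⟨ζ, hζ⟩
    rw [h_fact] at hζ
    refine ⟨le_antisymm (LinearMap.range_le_ker_iff.mpr hc1) fun x hx => ?_,
      le_antisymm (LinearMap.range_le_ker_iff.mpr hc2) fun x hx => ?_⟩
    · obtain ⟨f, hf⟩ := h_range.mpr hx
      obtain ⟨y, rfl⟩ := (ζ.surjective.comp hcSurj) f
      exact ⟨y, h_inj ((hζ y).symm.trans hf)⟩
    · rw [← hcKer, LinearMap.mem_ker, ← ζ.map_eq_zero_iff]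
      apply he_inj
      rw [hζ, LinearMap.mem_ker.mp hx, map_zero, map_zero]
  · rw [LinearEquiv.ker_comp, hcKer]
  · exact LinearMap.ext fun x => ((h_fact ζ).mp hζ x).symm
end

section
/- Let M' be a torsionless semi-Gorenstein-projective left A-module and let M = ℧M'. Then M is semi-Gorenstein-projective; moreover, (M')* is semi-Gorenstein-projective if and only if M* is semi-Gorenstein-projective and the canonical map φ_M : M → M** is an epimorphism. -/
/-!
Common background: `A` is an artin algebra (an algebra over a commutative artinian
ring `k`, finitely generated as `k`-module).  Left `A`-modules are `Module A M`;
right `A`-modules are `Module Aᵐᵒᵖ N`.  `Dl A M = Hom_A(M,A)` is the `A`-dual of a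
left module (a right module) and `Dr A N` the dual of a right module (a left module);
`evalL A M : M → M**` is the canonical evaluation map `φ_M`.
-/

open CategoryTheory LinearMap

universe u

/-- `ι : M' → P` is a left `add(A)`-approximation: `P` is a finitely generated projective
module and every homomorphism from `M'` to a projective module factors through `ι`. -/
def IsLeftAddApprox (A : Type u) [Ring A] {M' P : Type u} [AddCommGroup M'] [Module A M']
    [AddCommGroup P] [Module A P] (iota : M' →ₗ[A] P) : Prop :=
  Module.Projective A P ∧ Module.Finite A P ∧
    ∀ (P' : ModuleCat.{u} A), Module.Projective A (↥P') → ∀ g : M' →ₗ[A] (↥P'),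
      ∃ h : P →ₗ[A] (↥P'), h ∘ₗ iota = g

section ExtVanishing

open Abelian

/-- The left-derived `Ext` of positive degree vanishes iff the derived-category `Ext` does. -/
lemma isZero_Ext_succ_iff_subsingleton {C : Type*} [Category* C] [Abelian C] [EnoughProjectives C]
    [HasExt C] (X Y : C) (n : ℕ) :
    Limits.IsZero (((_root_.Ext ℤ C (n + 1)).obj (Opposite.op X)).obj Y) ↔
      Subsingleton (Abelian.Ext X Y (n + 1)) := by
  let R := ProjectiveResolution.of X
  rw [(R.isoExt (R := ℤ) (n + 1) Y).isZero_iff,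
    ← HomologicalComplex.exactAt_iff_isZero_homology,
    HomologicalComplex.exactAt_iff' _ n (n + 1) (n + 2) (by simp) (by simp),
    ShortComplex.moduleCat_exact_iff]
  constructor
  · intro h
    refine subsingleton_of_forall_eq 0 fun α => ?_
    obtain ⟨f, hf, rfl⟩ := R.extMk_surjective α (n + 2) rfl
    rw [R.extMk_eq_zero_iff f (n + 2) rfl hf n rfl]
    exact h f hf
  · intro h f hf
    exact (R.extMk_eq_zero_iff f (n + 2) rfl hf n rfl).1 (Subsingleton.elim _ _)

variable {R : Type u} [Ring R] {K Q M N : Type u} [AddCommGroup K] [Module R K]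
  [AddCommGroup Q] [Module R Q] [AddCommGroup M] [Module R M] [AddCommGroup N] [Module R N]
  {f : K →ₗ[R] Q} {g : Q →ₗ[R] M}

lemma extZero_succ_iff (n : ℕ) :
    extZero R M N (n + 1) ↔
      Subsingleton (Abelian.Ext (ModuleCat.of R M) (ModuleCat.of R N) (n + 1)) :=
  isZero_Ext_succ_iff_subsingleton _ _ n

/-- The short exact sequence in `ModuleCat R` given by an exact pair of linear maps. -/
lemma shortExact_ofHom (hf : Function.Injective f) (hfg : Function.Exact f g)
    (hg : Function.Surjective g) :
    (ShortComplex.mk (ModuleCat.ofHom f) (ModuleCat.ofHom g)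
      (by rw [← ModuleCat.ofHom_comp, hfg.linearMap_comp_eq_zero]; rfl)).ShortExact where
  exact := by
    rw [ShortComplex.moduleCat_exact_iff]
    exact fun x hx => (hfg x).1 hx
  mono_f := (ModuleCat.mono_iff_injective _).2 hf
  epi_g := (ModuleCat.epi_iff_surjective _).2 hg

/-- Dimension shifting along a short exact sequence with projective middle term. -/
lemma extZero_add_two_iff [Module.Projective R Q] (hf : Function.Injective f)
    (hfg : Function.Exact f g) (hg : Function.Surjective g) (n : ℕ) :
    extZero R M N (n + 2) ↔ extZero R K N (n + 1) := by
  have hS := shortExact_ofHom hf hfg hg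
  have : Projective (ModuleCat.of R Q) := IsProjective.iff_projective _ |>.1 inferInstance
  rw [extZero_succ_iff, extZero_succ_iff]
  constructor
  · intro h
    refine subsingleton_of_forall_eq 0 fun x => ?_
    obtain ⟨y, rfl⟩ := Ext.contravariant_sequence_exact₁ hS _ x (add_comm 1 (n + 1))
      (Subsingleton.elim (α := Abelian.Ext (ModuleCat.of R M) (ModuleCat.of R N) (n + 2)) _ _)
    rw [show y = 0 from Ext.eq_zero_of_projective _, Ext.comp_zero]
  · intro h
    refine subsingleton_of_forall_eq 0 fun x => ?_
    obtain ⟨y, rfl⟩ := Ext.contravariant_sequence_exact₃ hS _ x (Ext.eq_zero_of_projective _)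
      (add_comm 1 (n + 1))
    rw [show y = 0 from
      Subsingleton.elim (α := Abelian.Ext (ModuleCat.of R K) (ModuleCat.of R N) (n + 1)) _ _,
      Ext.comp_zero]

/-- `Ext¹(M, N)` vanishes iff maps to `N` extend along the inclusion of a syzygy of `M`. -/
lemma extZero_one_iff [Module.Projective R Q] (hf : Function.Injective f)
    (hfg : Function.Exact f g) (hg : Function.Surjective g) :
    extZero R M N 1 ↔ ∀ φ : K →ₗ[R] N, ∃ ψ : Q →ₗ[R] N, ψ ∘ₗ f = φ := by
  have hS := shortExact_ofHom hf hfg hg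
  have : Projective (ModuleCat.of R Q) := IsProjective.iff_projective _ |>.1 inferInstance
  rw [extZero_succ_iff]
  constructor
  · intro h φ
    obtain ⟨y, hy⟩ := Ext.contravariant_sequence_exact₁ hS _ (Ext.mk₀ (ModuleCat.ofHom φ))
      (add_comm 1 0)
      (Subsingleton.elim (α := Abelian.Ext (ModuleCat.of R M) (ModuleCat.of R N) 1) _ _)
    obtain ⟨ψ, rfl⟩ := (Ext.mk₀_bijective _ _).2 y
    rw [Ext.mk₀_comp_mk₀] at hy
    exact ⟨ψ.hom, congrArg ModuleCat.Hom.hom ((Ext.mk₀_bijective _ _).1 hy)⟩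
  · intro h
    refine subsingleton_of_forall_eq 0 fun x => ?_
    obtain ⟨y, rfl⟩ := Ext.contravariant_sequence_exact₃ hS _ x (Ext.eq_zero_of_projective _)
      (add_comm 1 0)
    obtain ⟨φ, rfl⟩ := (Ext.mk₀_bijective _ _).2 y
    obtain ⟨ψ, hψ⟩ := h φ.hom
    have hφ : φ = ModuleCat.ofHom f ≫ ModuleCat.ofHom ψ :=
      ModuleCat.hom_ext hψ.symm
    rw [hφ, ← Ext.mk₀_comp_mk₀]
    exact hS.extClass_comp_assoc _

end ExtVanishing

section Duality

variable {A : Type u} [Ring A]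

/-- Finite dual bases of finitely generated projective modules. -/
lemma exists_finite_dual_basis (P : Type u) [AddCommGroup P] [Module A P]
    [Module.Projective A P] [Module.Finite A P] :
    ∃ (n : ℕ) (p : Fin n → P) (s : Fin n → Dl A P), ∀ x, ∑ i, s i x • p i = x := by
  obtain ⟨n, g, hg⟩ := Module.Finite.exists_fin' A P
  obtain ⟨s, hs⟩ := Module.projective_lifting_property g LinearMap.id hg
  refine ⟨n, fun i => g (Pi.single i 1), fun i => LinearMap.proj i ∘ₗ s, fun x => ?_⟩
  conv_rhs => rw [← LinearMap.id_apply (R := A) x, ← hs, LinearMap.comp_apply,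
    LinearMap.pi_apply_eq_sum_univ g]
  refine Finset.sum_congr rfl fun i _ => congrArg (fun y => s x i • g y) (funext fun j => ?_)
  simp [Pi.single_apply, eq_comm]

lemma dual_basis_sum_op_smul {P : Type u} [AddCommGroup P] [Module A P] {n : ℕ} {p : Fin n → P}
    {s : Fin n → Dl A P} (h : ∀ x, ∑ i, s i x • p i = x) (f : Dl A P) :
    ∑ i, MulOpposite.op (f (p i)) • s i = f := by
  ext x
  conv_rhs => rw [← h x]
  simp

lemma projective_dual (P : Type u) [AddCommGroup P] [Module A P]
    [Module.Projective A P] [Module.Finite A P] : Module.Projective Aᵐᵒᵖ (Dl A P) := by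
  obtain ⟨n, p, s, h⟩ := exists_finite_dual_basis (A := A) P
  let i : Dl A P →ₗ[Aᵐᵒᵖ] (Fin n → Aᵐᵒᵖ) :=
    { toFun := fun f j => MulOpposite.op (f (p j))
      map_add' := fun f g => rfl
      map_smul' := fun a f => rfl }
  refine Module.Projective.of_split i (Fintype.linearCombination Aᵐᵒᵖ s) ?_
  ext1 f
  simpa [i, Fintype.linearCombination_apply] using dual_basis_sum_op_smul h f

lemma evalL_surjective_of_projective (P : Type u) [AddCommGroup P] [Module A P]
    [Module.Projective A P] [Module.Finite A P] : Function.Surjective (evalL A P) := by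
  obtain ⟨n, p, s, h⟩ := exists_finite_dual_basis (A := A) P
  intro ψ
  refine ⟨∑ i, ψ (s i) • p i, ?_⟩
  ext f
  conv_rhs => rw [← dual_basis_sum_op_smul h f]
  simp [evalL]

variable {M N L : Type u} [AddCommGroup M] [Module A M] [AddCommGroup N] [Module A N]
  [AddCommGroup L] [Module A L] {f : M →ₗ[A] N} {g : N →ₗ[A] L}

lemma evalL_naturality (g : N →ₗ[A] L) (x : N) :
    dualMapR (dualMapL g) (evalL A N x) = evalL A L (g x) := rfl

lemma dualMapL_injective_s6 (hg : Function.Surjective g) : Function.Injective (dualMapL g) :=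
  fun _ _ h => LinearMap.cancel_right hg |>.1 h

lemma dualMapL_exact (hfg : Function.Exact f g) (hg : Function.Surjective g) :
    Function.Exact (dualMapL g) (dualMapL f) := by
  intro h
  constructor
  · intro hh
    have hker : ker g ≤ ker h := by
      rw [hfg.linearMap_ker_eq]
      rintro _ ⟨x, rfl⟩
      exact LinearMap.congr_fun hh x
    refine ⟨(ker g).liftQ h hker ∘ₗ (g.quotKerEquivOfSurjective hg).symm.toLinearMap, ?_⟩
    ext x
    have : (g.quotKerEquivOfSurjective hg).symm (g x) = (ker g).mkQ x := by
      rw [LinearEquiv.symm_apply_eq]; rfl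
    change (ker g).liftQ h hker ((g.quotKerEquivOfSurjective hg).symm (g x)) = h x
    rw [this]
    rfl
  · rintro ⟨h, rfl⟩
    ext x
    change h (g (f x)) = 0
    rw [hfg.apply_apply_eq_zero, map_zero]

end Duality

/-- Proposition 3.1(2): for a torsionless semi-Gorenstein-projective `M'` and `M = ℧M'`
(the cokernel of a minimal left `add(A)`-approximation `ι : M' → P`), the module `M` is
semi-Gorenstein-projective, and `(M')^*` is semi-Gorenstein-projective iff `M^*` is
semi-Gorenstein-projective and `φ_M` is an epimorphism. -/
theorem mho_of_torsionless_sgp (k : Type u) [CommRing k] [IsArtinianRing k]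
    (A : Type u) [Ring A] [Algebra k A] [Module.Finite k A]
    (M' : Type u) [AddCommGroup M'] [Module A M'] [Module.Finite A M']
    (htl : Function.Injective (evalL A M')) (hsgp : sGp A M')
    (P : Type u) [AddCommGroup P] [Module A P] (iota : M' →ₗ[A] P)
    (happ : IsLeftAddApprox A iota)
    (hminapp : ∀ h : P →ₗ[A] P, h ∘ₗ iota = iota → Function.Bijective h) :
    sGp A (P ⧸ range iota) ∧
      (sGpR A (Dl A M') ↔
        (sGpR A (Dl A (P ⧸ range iota)) ∧
          Function.Surjective (evalL A (P ⧸ range iota)))) := by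
  obtain ⟨hproj, hfin, hfac⟩ := happ
  have hext : ∀ φ : M' →ₗ[A] A, ∃ ψ : P →ₗ[A] A, ψ ∘ₗ iota = φ :=
    hfac (ModuleCat.of A A) (inferInstanceAs (Module.Projective A A))
  have hinj : Function.Injective iota := by
    intro x y hxy
    apply htl
    ext φ
    obtain ⟨ψ, rfl⟩ := hext φ
    exact congrArg ψ hxy
  have hex : Function.Exact iota (range iota).mkQ := LinearMap.exact_map_mkQ_range iota
  have hsurj := (range iota).mkQ_surjective
  have hprojDual := projective_dual (A := A) P
  have hinj' := dualMapL_injective_s6 hsurj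
  have hex' := dualMapL_exact hex hsurj
  have hsurj' : Function.Surjective (dualMapL iota) := hext
  have hone : extZero Aᵐᵒᵖ (Dl A M') A 1 ↔ Function.Surjective (evalL A (P ⧸ range iota)) := by
    rw [extZero_one_iff hinj' hex' hsurj']
    constructor
    · intro h φ
      obtain ⟨ψ, rfl⟩ := h φ
      obtain ⟨x, rfl⟩ := evalL_surjective_of_projective P ψ
      exact ⟨(range iota).mkQ x, (evalL_naturality _ x).symm⟩
    · intro h φ
      obtain ⟨y, rfl⟩ := h φ
      obtain ⟨x, rfl⟩ := hsurj y
      exact ⟨evalL A P x, evalL_naturality _ x⟩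
  refine ⟨fun i hi => ?_, fun h => ⟨fun i hi => ?_, hone.1 (h 1 le_rfl)⟩, fun h i hi => ?_⟩
  · obtain ⟨_ | n, rfl⟩ := Nat.exists_eq_add_of_le' hi
    · exact (extZero_one_iff hinj hex hsurj).2 hext
    · exact (extZero_add_two_iff hinj hex hsurj n).2 (hsgp _ n.succ_pos)
  · obtain ⟨n, rfl⟩ := Nat.exists_eq_add_of_le' hi
    exact (extZero_add_two_iff hinj' hex' hsurj' n).1 (h _ (n + 1).succ_pos)
  · obtain ⟨_ | n, rfl⟩ := Nat.exists_eq_add_of_le' hi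
    · exact hone.2 h.2
    · exact (extZero_add_two_iff hinj' hex' hsurj' n).2 (h.1 _ n.succ_pos)
end
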